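/- arXiv:0906.4668 — 4 statements merged into one kernel-verified Lean document; each statement's English description precedes it below -/
import Mathlib

section
/- Correctness of the (t,n)-threshold ElGamal combining algorithm: Let q be a prime, G a commutative group, g ∈ G an element of order q. Let f be a polynomial over Z_q with deg f ≤ t−1, let α = f(0) be the secret key, and h = g^α the public key component. Let m ∈ G be a plaintext, r ∈ Z_q, and let (a, b) = (g^r, m·h^r) be the ciphertext. Let S be a finite index set with |S| = t and x : S → Z_q injective on S, and let c_i = a^(f(x_i)) for i ∈ S be the t partial decryptions. Then b · ( ∏_{i∈S} c_i^( λ^S_{0,i} ) )⁻¹ = m. -/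
open Polynomial Finset

/-- Lagrange coefficient `λ^S_{x₀,i}` with respect to nodes `x i`, `i ∈ S`,
and target point `x₀`. -/
noncomputable def lagrangeCoeff {q : ℕ} [Fact (Nat.Prime q)] {ι : Type*} [DecidableEq ι]
    (S : Finset ι) (x : ι → ZMod q) (x₀ : ZMod q) (i : ι) : ZMod q :=
  ∏ i' ∈ S.erase i, (x₀ - x i') / (x i - x i')

theorem eval_lagrange_basis_eq_lagrangeCoeff {q : ℕ} [Fact (Nat.Prime q)] {ι : Type*}
    [DecidableEq ι] (S : Finset ι) (x : ι → ZMod q) (x₀ : ZMod q) (i : ι) :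
    (Lagrange.basis S x i).eval x₀ = lagrangeCoeff S x x₀ i := by
  simp [Lagrange.basis, Lagrange.basisDivisor, lagrangeCoeff, eval_prod, div_eq_inv_mul]

/-- Lagrange interpolation with explicit coefficients. -/
theorem eval_eq_sum_lagrangeCoeff_mul_eval {q : ℕ} [Fact (Nat.Prime q)] {ι : Type*}
    [DecidableEq ι] {S : Finset ι} {x : ι → ZMod q} (hx : Set.InjOn x S)
    {f : Polynomial (ZMod q)} (hf : f.degree < S.card) (x₀ : ZMod q) :
    f.eval x₀ = ∑ i ∈ S, lagrangeCoeff S x x₀ i * f.eval (x i) := by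
  refine (congrArg (eval x₀) (Lagrange.eq_interpolate hx hf)).trans ?_
  simp only [Lagrange.interpolate_apply, eval_finsetSum, eval_mul, eval_C,
    eval_lagrange_basis_eq_lagrangeCoeff, mul_comm]

theorem pow_eq_pow_of_natCast_eq_zmod_orderOf {G : Type*} [Monoid G] {g : G} {q : ℕ}
    (hg : orderOf g = q) {k l : ℕ} (hkl : (k : ZMod q) = l) : g ^ k = g ^ l := by
  rw [ZMod.natCast_eq_natCast_iff, ← hg] at hkl
  rw [← pow_mod_orderOf g k, hkl, pow_mod_orderOf]

/-- Correctness of the (t,n)-threshold ElGamal combining algorithm. -/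
theorem threshold_elgamal_combining_correct
    {q : ℕ} [Fact (Nat.Prime q)] {G : Type*} [CommGroup G] (g : G)
    (hg : orderOf g = q) {ι : Type*} [DecidableEq ι] {t : ℕ} (ht : 1 ≤ t)
    (f : Polynomial (ZMod q)) (hf : f.natDegree ≤ t - 1)
    (α : ZMod q) (hα : α = f.eval 0) (h : G) (hh : h = g ^ α.val)
    (m : G) (r : ZMod q) (a b : G) (ha : a = g ^ r.val) (hb : b = m * h ^ r.val)
    (S : Finset ι) (hS : S.card = t) (x : ι → ZMod q) (hx : Set.InjOn x S)
    (c : ι → G) (hc : ∀ i ∈ S, c i = a ^ (f.eval (x i)).val) :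
    b * (∏ i ∈ S, (c i) ^ (lagrangeCoeff S x 0 i).val)⁻¹ = m := by
  have hdeg : f.degree < S.card :=
    degree_le_natDegree.trans_lt (by exact_mod_cast (by omega : f.natDegree < S.card))
  have hprod : ∏ i ∈ S, c i ^ (lagrangeCoeff S x 0 i).val = h ^ r.val := by
    rw [prod_congr rfl fun i hi => by rw [hc i hi, ha, ← pow_mul, ← pow_mul],
      prod_pow_eq_pow_sum, hh, ← pow_mul]
    refine pow_eq_pow_of_natCast_eq_zmod_orderOf hg ?_
    push_cast
    simp only [ZMod.natCast_val, ZMod.cast_id', id_eq]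
    rw [hα, eval_eq_sum_lagrangeCoeff_mul_eval hx hdeg, sum_mul]
    exact sum_congr rfl fun i _ => by ring
  rw [hprod, hb, mul_inv_cancel_right]
end

section
/- Counting polynomials consistent with fewer than t shares: Let q be a prime, t ≥ 1, and 0 ≤ k ≤ t−1. Let x : Fin k → Z_q be injective with x_i ≠ 0 for all i, let y : Fin k → Z_q be arbitrary prescribed values, and let α ∈ Z_q. Then the set of polynomials f over Z_q with deg f ≤ t−1, f(0) = α, and f(x_i) = y_i for all i ∈ Fin k has cardinality exactly q^(t−1−k). In particular this cardinality does not depend on α, so any k ≤ t−1 shares give no information about the secret f(0). -/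
open Polynomial

theorem Polynomial.degree_mul_lt_add_iff {F : Type*} [Field F] {p : F[X]} {m : ℕ}
    (hp : p.degree = m) (g : F[X]) (d : ℕ) :
    (p * g).degree < ((m + d : ℕ) : WithBot ℕ) ↔ g.degree < d := by
  rw [degree_mul, hp, Nat.cast_add]
  exact WithBot.add_lt_add_iff_left WithBot.coe_ne_bot

/-- Over a finite field, the number of polynomials of degree less than `m + d` with prescribed
values at `m` distinct nodes is the `d`-th power of the size of the field. -/
theorem Lagrange.card_degree_lt_eval_eq {F ι : Type*} [Field F] [Fintype ι]
    {v : ι → F} (hv : Function.Injective v) (r : ι → F) (d : ℕ) :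
    Nat.card {f : F[X] // f.degree < ((Fintype.card ι + d : ℕ) : WithBot ℕ) ∧
      ∀ i, f.eval (v i) = r i} = Nat.card F ^ d := by
  classical
  set N := nodal Finset.univ v
  set P := interpolate Finset.univ v r
  have hNmonic : N.Monic := nodal_monic
  have hNdeg : N.degree = (Fintype.card ι : ℕ) := degree_nodal
  have hNeval : ∀ i, N.eval (v i) = 0 := fun i => eval_nodal_at_node (Finset.mem_univ i)
  have hPdeg : P.degree < (Fintype.card ι : ℕ) := degree_interpolate_lt r hv.injOn
  have hPlt : P.degree < ((Fintype.card ι + d : ℕ) : WithBot ℕ) :=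
    hPdeg.trans_le (by exact_mod_cast Nat.le_add_right _ _)
  have hPeval : ∀ i, P.eval (v i) = r i := fun i =>
    eval_interpolate_at_node r hv.injOn (Finset.mem_univ i)
  let φ : degreeLT F d → {f : F[X] // f.degree < ((Fintype.card ι + d : ℕ) : WithBot ℕ) ∧
      ∀ i, f.eval (v i) = r i} := fun g =>
    ⟨P + N * g, (degree_add_le _ _).trans_lt (max_lt hPlt
        ((degree_mul_lt_add_iff hNdeg _ _).2 (mem_degreeLT.1 g.2))),
      fun i => by simp [hPeval, hNeval]⟩
  have hφ : Function.Bijective φ := by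
    refine ⟨fun g h hgh => Subtype.ext ?_, fun ⟨f, hf, hfr⟩ => ?_⟩
    · exact mul_left_cancel₀ hNmonic.ne_zero (add_left_cancel (congrArg Subtype.val hgh))
    · have hmod : f %ₘ N = P := by
        refine eq_interpolate_of_eval_eq r hv.injOn ?_ fun i _ => ?_
        · exact (degree_modByMonic_lt f hNmonic).trans_eq hNdeg
        · rw [← hfr i]
          conv_rhs => rw [← modByMonic_add_div f N]
          simp [hNeval]
      have hdiv : P + N * (f /ₘ N) = f := hmod ▸ modByMonic_add_div f N
      refine ⟨⟨f /ₘ N, mem_degreeLT.2 ((degree_mul_lt_add_iff hNdeg _ _).1 ?_)⟩,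
        Subtype.ext hdiv⟩
      rw [eq_sub_of_add_eq' hdiv]
      exact (degree_sub_le _ _).trans_lt (max_lt hf hPlt)
  rw [← Nat.card_congr (Equiv.ofBijective φ hφ), Nat.card_congr (degreeLTEquiv F d).toEquiv,
    Nat.card_fun, Nat.card_fin]

/-- Counting polynomials consistent with fewer than `t` shares: the set of
polynomials of degree at most `t − 1` with constant term `α` passing through `k`
prescribed points (at pairwise distinct nonzero nodes, `k ≤ t − 1`) has exactly
`q ^ (t − 1 − k)` elements; in particular this number does not depend on `α`. -/
theorem count_polynomials_consistent_with_shares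
    {q : ℕ} [Fact (Nat.Prime q)] {t k : ℕ} (ht : 1 ≤ t) (hk : k ≤ t - 1)
    (x : Fin k → ZMod q) (hx : Function.Injective x) (hx0 : ∀ i, x i ≠ 0)
    (y : Fin k → ZMod q) (α : ZMod q) :
    Nat.card {f : Polynomial (ZMod q) //
        f.natDegree ≤ t - 1 ∧ f.eval 0 = α ∧ ∀ i, f.eval (x i) = y i} =
      q ^ (t - 1 - k) := by
  have hv : Function.Injective (fun o : Option (Fin k) => o.elim 0 x) := by
    rintro (_ | i) (_ | j) h
    · rfl
    · exact absurd h.symm (hx0 j)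
    · exact absurd h (hx0 i)
    · exact congrArg some (hx h)
  have hcard := Lagrange.card_degree_lt_eval_eq hv (fun o => o.elim α y) (t - 1 - k)
  rw [Nat.card_zmod] at hcard
  rw [← hcard]
  refine Nat.card_congr (Equiv.subtypeEquivRight fun f => and_congr ?_ ?_)
  · rw [Fintype.card_option, Fintype.card_fin, show k + 1 + (t - 1 - k) = t - 1 + 1 by omega,
      degree_lt_iff_coeff_zero, natDegree_le_iff_coeff_eq_zero]
    rfl
  · simp [Option.forall]
end

section
/- Perfect secrecy of t−1 Shamir shares: Let q be a prime and t ≥ 1, and let x : Fin (t−1) → Z_q be injective with x_i ≠ 0 for all i. For a secret α ∈ Z_q and a coefficient vector a ∈ (Z_q)^(t−1), let f_{α,a} be the polynomial α + Σ_{j∈Fin (t−1)} a_j · X^(j+1). Then the pushforward of the uniform probability distribution (PMF) on (Z_q)^(t−1) under the share map a ↦ (f_{α,a}(x_1), …, f_{α,a}(x_{t−1})) is the uniform distribution on (Z_q)^(t−1); in particular, for any two secrets α, α' ∈ Z_q the resulting share distributions are equal. -/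
open Polynomial

theorem PMF.map_uniformOfFintype_of_bijective {β γ : Type*} [Fintype β] [Nonempty β]
    [Fintype γ] [Nonempty γ] {f : β → γ} (hf : Function.Bijective f) :
    (PMF.uniformOfFintype β).map f = PMF.uniformOfFintype γ := by
  classical
  ext c
  obtain ⟨b, rfl⟩ := hf.surjective c
  simp [PMF.map_apply, hf.injective.eq_iff, Fintype.card_of_bijective hf]

theorem shamir_shares_injective {R : Type*} [CommRing R] [IsDomain R] {n : ℕ}
    {x : Fin n → R} (hx : Function.Injective x) (hx0 : ∀ i, x i ≠ 0) (α : R) :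
    Function.Injective fun (a : Fin n → R) (i : Fin n) =>
      (C α + ∑ j : Fin n, C (a j) * X ^ ((j : ℕ) + 1)).eval (x i) := by
  intro a b hab
  rw [← sub_eq_zero]
  refine Matrix.eq_zero_of_mulVec_eq_zero (Matrix.det_vandermonde_ne_zero_iff.2 hx) ?_
  rw [Matrix.mulVec_sub, sub_eq_zero]
  ext i
  refine mul_left_cancel₀ (hx0 i) ?_
  have h := congrFun hab i
  simp only [eval_add, eval_C, eval_finsetSum, eval_mul, eval_pow, eval_X,
    add_right_inj] at h
  simpa only [Matrix.mulVec, dotProduct, Matrix.vandermonde_apply, Finset.mul_sum, pow_succ,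
    mul_comm, mul_left_comm] using h

/-- Perfect secrecy of `t − 1` Shamir shares: the shares
`(f_{α,a}(x₁), …, f_{α,a}(x_{t−1}))` of the secret `α`, where
`f_{α,a}(X) = α + Σ_j a_j X^(j+1)` and the coefficient vector `a` is uniformly
random, are themselves uniformly distributed (hence their distribution is
independent of the secret `α`). -/
theorem shamir_perfect_secrecy
    {q : ℕ} [Fact (Nat.Prime q)] {t : ℕ} (ht : 1 ≤ t)
    (x : Fin (t - 1) → ZMod q) (hx : Function.Injective x) (hx0 : ∀ i, x i ≠ 0)
    (α : ZMod q) :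
    (PMF.uniformOfFintype (Fin (t - 1) → ZMod q)).map
        (fun (a : Fin (t - 1) → ZMod q) (i : Fin (t - 1)) =>
          (C α + ∑ j : Fin (t - 1), C (a j) * X ^ ((j : ℕ) + 1)).eval (x i)) =
      PMF.uniformOfFintype (Fin (t - 1) → ZMod q) := by
  exact PMF.map_uniformOfFintype_of_bijective
    (Finite.injective_iff_bijective.1 (shamir_shares_injective hx hx0 α))
end

section
/- Re-randomization produces a fresh uniformly random encryption of the same plaintext: Let q be a prime, G a commutative group, and g ∈ G an element of order q. Let α ∈ Z_q, h = g^α, m ∈ G, r ∈ Z_q, and let (a, b) = (g^r, m·h^r) be an ElGamal encryption of m. Then the pushforward of the uniform probability distribution (PMF) on Z_q under the re-randomization map r' ↦ (a·g^(r'), b·h^(r')) equals the pushforward of the uniform distribution on Z_q under the fresh-encryption map s ↦ (g^s, m·h^s). -/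
theorem PMF.map_equiv_uniformOfFintype {β : Type*} [Fintype β] [Nonempty β] (e : β ≃ β) :
    (PMF.uniformOfFintype β).map e = PMF.uniformOfFintype β := by
  classical
  ext y
  rw [PMF.map_apply, tsum_eq_single (e.symm y)]
  · simp
  · intro x hx
    rw [if_neg]
    rintro rfl
    simp at hx

theorem pow_zmod_val_add {M : Type*} [Monoid M] {n : ℕ} [NeZero n] {x : M} (hx : x ^ n = 1)
    (i j : ZMod n) : x ^ (i + j).val = x ^ i.val * x ^ j.val := by
  rw [ZMod.val_add, ← pow_eq_pow_mod _ hx, pow_add]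

/-- Re-randomization produces a fresh uniformly random encryption of the same
plaintext: the distribution of `(a·g^r', b·h^r')` for uniformly random `r'`
equals the distribution of a fresh encryption `(g^s, m·h^s)` for uniformly
random `s`. -/
theorem rerandomization_fresh_encryption
    {q : ℕ} [Fact (Nat.Prime q)] {G : Type*} [CommGroup G] (g : G)
    (hg : orderOf g = q)
    (α : ZMod q) (h : G) (hh : h = g ^ α.val)
    (m : G) (r : ZMod q) (a b : G) (ha : a = g ^ r.val) (hb : b = m * h ^ r.val) :
    (PMF.uniformOfFintype (ZMod q)).map
        (fun r' : ZMod q => (a * g ^ r'.val, b * h ^ r'.val)) =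
      (PMF.uniformOfFintype (ZMod q)).map
        (fun s : ZMod q => (g ^ s.val, m * h ^ s.val)) := by
  have hgq : g ^ q = 1 := hg ▸ pow_orderOf_eq_one g
  have hhq : h ^ q = 1 := by rw [hh, ← pow_mul, mul_comm, pow_mul, hgq, one_pow]
  conv_rhs => rw [← PMF.map_equiv_uniformOfFintype (Equiv.addLeft r), PMF.map_comp]
  congr 1
  funext r'
  simp only [Function.comp_apply, Equiv.coe_addLeft, pow_zmod_val_add hgq, pow_zmod_val_add hhq,
    ha, hb, mul_assoc]
end
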